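/- arXiv:1607.05830 — 10 statements merged into one kernel-verified Lean document; each statement's English description precedes it below -/
import Mathlib

section
/- For every probability measure μ on (Set H, 𝔅), every finite set b ⊆ H, and every a ⊆ b, the measure of the atom A_{a,b} is given by the inclusion-exclusion formula μ(A_{a,b}) = ∑_{c : a ⊆ c ⊆ b} (−1)^{|c \ a|} · μ(B_c), where the sum ranges over the finitely many sets c with a ⊆ c ⊆ b. -/
open MeasureTheory Set

/-- A set of subsets of `H` is Scott-open if it is an upper set for inclusion and
meets every directed family of subsets whose union it contains. -/
def ScottOpen {H : Type*} (U : Set (Set H)) : Prop :=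
  (∀ ⦃a b : Set H⦄, a ⊆ b → a ∈ U → b ∈ U) ∧
  ∀ D : Set (Set H), D.Nonempty → DirectedOn (· ⊆ ·) D → ⋃₀ D ∈ U → (D ∩ U).Nonempty

/-- The Borel σ-algebra on `Set H` generated by the Scott-open sets. -/
def scottBorel (H : Type*) : MeasurableSpace (Set H) :=
  MeasurableSpace.generateFrom {U : Set (Set H) | ScottOpen U}

/-- `B_b = {c | b ⊆ c}`. -/
def Bset {H : Type*} (b : Set H) : Set (Set H) := {c | b ⊆ c}

/-- The atom `A_{a,b} = {c | c ∩ b = a}`. -/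
def Atom {H : Type*} (a b : Set H) : Set (Set H) := {c | c ∩ b = a}

theorem scottOpen_Bset {H : Type*} (b : Finset H) : ScottOpen (Bset (b : Set H)) := by
  refine ⟨fun c d hcd hc => Set.Subset.trans hc hcd, fun D hne hD hb => ?_⟩
  obtain ⟨c, hc, hbc⟩ :=
    hD.exists_mem_subset_of_finite_of_subset_sUnion hne b.finite_toSet hb
  exact ⟨c, hc, hbc⟩

theorem measurableSet_Bset {H : Type*} (b : Finset H) :
    MeasurableSet[scottBorel H] (Bset (b : Set H)) :=
  MeasurableSpace.measurableSet_generateFrom (scottOpen_Bset b)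

theorem Atom_self {H : Type*} (a : Set H) : Atom a a = Bset a := by
  ext c
  simp [Atom, Bset]

theorem Atom_union_insert {H : Type*} (a s : Set H) {x : H} (hxa : x ∉ a) :
    Atom a (a ∪ insert x s) = Atom a (a ∪ s) \ Atom (insert x a) (insert x a ∪ s) := by
  ext c
  simp only [Atom, Set.mem_sdiff, Set.mem_ofPred_eq, Set.ext_iff, Set.mem_inter_iff,
    Set.mem_union, Set.mem_insert_iff]
  grind

theorem Atom_insert_subset {H : Type*} (a s : Set H) {x : H} (hxs : x ∉ s) :
    Atom (insert x a) (insert x a ∪ s) ⊆ Atom a (a ∪ s) := by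
  intro c
  simp only [Atom, Set.mem_ofPred_eq, Set.ext_iff, Set.mem_inter_iff,
    Set.mem_union, Set.mem_insert_iff]
  grind

theorem measurableSet_Atom_union {H : Type*} [DecidableEq H] (s a : Finset H)
    (h : Disjoint a s) : MeasurableSet[scottBorel H] (Atom (a : Set H) (a ∪ s)) := by
  induction s using Finset.induction_on generalizing a with
  | empty => simpa [Atom_self] using measurableSet_Bset a
  | insert x s hxs ih =>
    rw [Finset.disjoint_insert_right] at h
    rw [Finset.coe_insert, Atom_union_insert _ _ (by simpa using h.1)]
    have hx := ih (insert x a) (Finset.disjoint_insert_left.2 ⟨hxs, h.2⟩)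
    rw [Finset.coe_insert] at hx
    exact (ih a h.2).diff hx

theorem measureReal_Atom_union {H : Type*} [DecidableEq H]
    (μ : @Measure (Set H) (scottBorel H))
    (hμ : @IsFiniteMeasure (Set H) (scottBorel H) μ)
    (s a : Finset H) (h : Disjoint a s) :
    (μ (Atom (a : Set H) (a ∪ s))).toReal =
      ∑ t ∈ s.powerset, (-1 : ℝ) ^ t.card * (μ (Bset ((a ∪ t : Finset H) : Set H))).toReal := by
  induction s using Finset.induction_on generalizing a with
  | empty => simp [Atom_self]
  | insert x s hxs ih =>
    rw [Finset.disjoint_insert_right] at h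
    have hd : Disjoint (insert x a) s := Finset.disjoint_insert_left.2 ⟨hxs, h.2⟩
    have hxa : x ∉ (a : Set H) := by simpa using h.1
    have hm := measurableSet_Atom_union s (insert x a) hd
    have hx := ih (insert x a) hd
    rw [Finset.coe_insert] at hm hx
    have hsub := Atom_insert_subset (a : Set H) s (by simpa using hxs)
    rw [Finset.coe_insert, Atom_union_insert _ _ hxa,
      measure_sdiff hsub hm.nullMeasurableSet (measure_ne_top μ _),
      ENNReal.toReal_sub_of_le (measure_mono hsub) (measure_ne_top μ _), ih a h.2, hx,
      Finset.sum_powerset_insert hxs, sub_eq_add_neg, ← Finset.sum_neg_distrib]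
    congr 1
    refine Finset.sum_congr rfl fun t ht => ?_
    have hxt : x ∉ t := fun hxt => hxs (Finset.mem_powerset.1 ht hxt)
    rw [Finset.card_insert_of_notMem hxt, Finset.insert_union, Finset.union_insert, pow_succ]
    ring

/-- Inclusion-exclusion: the measure of the atom `A_{a,b}` is the alternating sum of the
measures of the basic Scott-open sets `B_c` for `a ⊆ c ⊆ b`. -/
theorem atom_eq_alternating_sum {H : Type*} [Countable H] [DecidableEq H]
    (μ : @Measure (Set H) (scottBorel H))
    (hμ : @IsProbabilityMeasure (Set H) (scottBorel H) μ)
    (b a : Finset H) (hab : a ⊆ b) :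
    (μ (Atom (↑a) (↑b))).toReal =
      ∑ c ∈ b.powerset.filter (fun c => a ⊆ c),
        (-1 : ℝ) ^ (c \ a).card * (μ (Bset (↑c))).toReal := by
  have key := measureReal_Atom_union μ inferInstance (b \ a) a Finset.disjoint_sdiff
  rw [← Finset.coe_union, Finset.union_sdiff_of_subset hab] at key
  rw [key]
  refine Finset.sum_bij' (fun t _ => a ∪ t) (fun c _ => c \ a) ?_ ?_ ?_ ?_ ?_
  · intro t ht
    simp only [Finset.mem_filter, Finset.mem_powerset] at ht ⊢
    grind
  · intro c hc
    simp only [Finset.mem_filter, Finset.mem_powerset] at hc ⊢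
    grind
  · intro t ht
    simp only [Finset.mem_powerset] at ht
    grind
  · intro c hc
    exact Finset.union_sdiff_of_subset (Finset.mem_filter.1 hc).2
  · intro t ht
    have hta : (a ∪ t) \ a = t := by
      simp only [Finset.mem_powerset] at ht
      grind
    rw [hta]
end

section
/- If μ and ν are probability measures on (Set H, 𝔅) such that μ(B_b) = ν(B_b) for every finite set b ⊆ H, then μ = ν; that is, a probability measure on (Set H, 𝔅) is uniquely determined by its values on the sets B_b for b finite. -/
open MeasureTheory Set

theorem ScottOpen.exists_finset_subset_mem {H : Type*} {U : Set (Set H)} (hU : ScottOpen U)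
    {c : Set H} (hc : c ∈ U) : ∃ b : Finset H, (b : Set H) ⊆ c ∧ (b : Set H) ∈ U := by
  classical
  obtain ⟨_, ⟨b, hbc, rfl⟩, hbU⟩ := hU.2 ((fun b : Finset H => (b : Set H)) '' {b | (b : Set H) ⊆ c})
    ⟨∅, ∅, by simp⟩
    (by
      rintro _ ⟨x, hx, rfl⟩ _ ⟨y, hy, rfl⟩
      exact ⟨_, ⟨x ∪ y, by simpa using ⟨hx, hy⟩, rfl⟩, by simp, by simp⟩)
    (hU.1 (fun x hx => mem_sUnion.2 ⟨{x}, ⟨{x}, by simpa using hx, by simp⟩, rfl⟩) hc)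
  exact ⟨b, hbc, hbU⟩

theorem ScottOpen.eq_biUnion_Bset {H : Type*} {U : Set (Set H)} (hU : ScottOpen U) :
    U = ⋃ b ∈ {b : Finset H | (b : Set H) ∈ U}, Bset (b : Set H) := by
  ext c
  simp only [mem_iUnion, exists_prop]
  constructor
  · intro hc
    obtain ⟨b, hbc, hbU⟩ := hU.exists_finset_subset_mem hc
    exact ⟨b, hbU, hbc⟩
  · rintro ⟨b, hbU, hbc⟩
    exact hU.1 hbc hbU

theorem scottBorel_eq_generateFrom_Bset (H : Type*) [Countable H] :
    scottBorel H =
      MeasurableSpace.generateFrom (range fun b : Finset H => Bset (b : Set H)) := by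
  apply le_antisymm
  · refine MeasurableSpace.generateFrom_le fun U (hU : ScottOpen U) => ?_
    rw [hU.eq_biUnion_Bset]
    exact MeasurableSet.biUnion (to_countable _) fun b _ =>
      MeasurableSpace.measurableSet_generateFrom ⟨b, rfl⟩
  · refine MeasurableSpace.generateFrom_mono ?_
    rintro _ ⟨b, rfl⟩
    exact scottOpen_Bset b

theorem isPiSystem_range_Bset (H : Type*) :
    IsPiSystem (range fun b : Finset H => Bset (b : Set H)) := by
  classical
  rintro _ ⟨x, rfl⟩ _ ⟨y, rfl⟩ -
  refine ⟨x ∪ y, ?_⟩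
  ext c
  simp [Bset]

/-- A probability measure on `(Set H, 𝔅)` is uniquely determined by its values on the
sets `B_b` for finite `b`. -/
theorem measure_ext_of_Bset {H : Type*} [Countable H]
    (μ ν : @Measure (Set H) (scottBorel H))
    (hμ : @IsProbabilityMeasure (Set H) (scottBorel H) μ)
    (hν : @IsProbabilityMeasure (Set H) (scottBorel H) ν)
    (h : ∀ b : Finset H, μ (Bset (↑b)) = ν (Bset (↑b))) : μ = ν := by
  let _ := scottBorel H
  refine ext_of_generate_finite _ (scottBorel_eq_generateFrom_Bset H)
    (isPiSystem_range_Bset H) ?_ (by rw [measure_univ, measure_univ])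
  rintro _ ⟨b, rfl⟩
  exact h b
end

section
/- The σ-algebra on Set H generated by the Scott topology coincides with the σ-algebra generated by the Cantor topology, and both coincide with the σ-algebra generated by the countable family of sets B_{{h}} = {c : Set H | h ∈ c} for h : H; in particular, although the Scott topology is strictly coarser than the Cantor topology, the two topologies have the same Borel sets. -/
open MeasureTheory Set

/-- The Cantor topology on `Set H`: generated by the sets `B_{h} = {c | h ∈ c}` and
their complements. -/
def cantorTop (H : Type*) : TopologicalSpace (Set H) :=
  TopologicalSpace.generateFrom
    ({U | ∃ h : H, U = {c : Set H | h ∈ c}} ∪ {U | ∃ h : H, U = {c : Set H | h ∉ c}})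

/-- A set belonging to a Scott-open set has a finite subset belonging to it. -/
theorem ScottOpen.exists_finset_subset {H : Type*} {U : Set (Set H)} (hU : ScottOpen U)
    {c : Set H} (hc : c ∈ U) : ∃ b : Finset H, ↑b ⊆ c ∧ (b : Set H) ∈ U := by
  classical
  obtain ⟨_, ⟨b, hbc, rfl⟩, hbU⟩ := hU.2 {d | ∃ b : Finset H, ↑b ⊆ c ∧ (b : Set H) = d}
    ⟨∅, ∅, by simp, by simp⟩
    (by
      rintro _ ⟨b, hb, rfl⟩ _ ⟨b', hb', rfl⟩
      exact ⟨_, ⟨b ∪ b', by simp [hb, hb'], rfl⟩, by simp, by simp⟩)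
    (hU.1 (fun h hh => ⟨{h}, ⟨{h}, by simpa using hh, by simp⟩, rfl⟩) hc)
  exact ⟨b, hbc, hbU⟩

theorem ScottOpen.eq_biUnion {H : Type*} {U : Set (Set H)} (hU : ScottOpen U) :
    U = ⋃ b ∈ {b : Finset H | (b : Set H) ∈ U}, ⋂ h ∈ b, {c : Set H | h ∈ c} := by
  ext c
  simp only [mem_iUnion, mem_iInter, mem_ofPred_eq, exists_prop]
  constructor
  · intro hc
    obtain ⟨b, hbc, hbU⟩ := hU.exists_finset_subset hc
    exact ⟨b, hbU, fun _ hh => hbc hh⟩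
  · rintro ⟨b, hbU, hbc⟩
    exact hU.1 (fun _ hh => hbc _ hh) hbU

theorem scottOpen_setOf_mem {H : Type*} (h : H) : ScottOpen {c : Set H | h ∈ c} := by
  refine ⟨fun _ _ hab ha => hab ha, ?_⟩
  rintro D - - ⟨d, hd, hh⟩
  exact ⟨d, hd, hh⟩

theorem ScottOpen.isOpen_cantorTop {H : Type*} {U : Set (Set H)} (hU : ScottOpen U) :
    (cantorTop H).IsOpen U := by
  let := cantorTop H
  change IsOpen U
  rw [hU.eq_biUnion]
  exact isOpen_biUnion fun b _ => isOpen_biInter_finset fun h _ =>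
    TopologicalSpace.isOpen_generateFrom_of_mem (Or.inl ⟨h, rfl⟩)

theorem not_scottOpen_setOf_notMem {H : Type*} (h : H) : ¬ ScottOpen {c : Set H | h ∉ c} :=
  fun hU => hU.1 (empty_subset {h}) (notMem_empty h) rfl

theorem borel_cantorTop (H : Type*) [Countable H] :
    MeasurableSpace.generateFrom {U : Set (Set H) | (cantorTop H).IsOpen U} =
      MeasurableSpace.generateFrom (range fun h : H => {c : Set H | h ∈ c}) := by
  have hrange : ({U | ∃ h : H, U = {c : Set H | h ∈ c}} ∪
      {U | ∃ h : H, U = {c : Set H | h ∉ c}} : Set (Set (Set H))) =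
      (range fun h : H => {c : Set H | h ∈ c}) ∪ range fun h : H => {c : Set H | h ∉ c} := by
    ext U
    simp [eq_comm]
  have hsc : @SecondCountableTopology (Set H) (cantorTop H) :=
    @SecondCountableTopology.mk _ (cantorTop H)
      ⟨_, hrange ▸ (countable_range _).union (countable_range _), rfl⟩
  refine (@borel_eq_generateFrom_of_subbasis (Set H) _ (cantorTop H) hsc rfl).trans (le_antisymm ?_ ?_)
  · refine MeasurableSpace.generateFrom_le ?_
    rintro _ (⟨h, rfl⟩ | ⟨h, rfl⟩)
    · exact MeasurableSpace.measurableSet_generateFrom ⟨h, rfl⟩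
    · exact (MeasurableSpace.measurableSet_generateFrom (mem_range_self h)).compl
  · rw [hrange]
    exact MeasurableSpace.generateFrom_mono subset_union_left

/-- The Scott topology is coarser than the Cantor topology (strictly so when `H` is
nonempty), but the σ-algebra generated by the Scott-open sets, the σ-algebra generated
by the Cantor-open sets, and the σ-algebra generated by the countable family of sets
`B_{h}` for `h : H` all coincide. -/
theorem scott_cantor_same_borel (H : Type*) [Countable H] :
    (∀ U : Set (Set H), ScottOpen U → (cantorTop H).IsOpen U) ∧
    (Nonempty H → ∃ U : Set (Set H), (cantorTop H).IsOpen U ∧ ¬ ScottOpen U) ∧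
    MeasurableSpace.generateFrom {U : Set (Set H) | ScottOpen U} =
      MeasurableSpace.generateFrom {U : Set (Set H) | (cantorTop H).IsOpen U} ∧
    MeasurableSpace.generateFrom {U : Set (Set H) | ScottOpen U} =
      MeasurableSpace.generateFrom (Set.range fun h : H => {c : Set H | h ∈ c}) := by
  have hscott : MeasurableSpace.generateFrom {U : Set (Set H) | ScottOpen U} =
      MeasurableSpace.generateFrom (range fun h : H => {c : Set H | h ∈ c}) := by
    refine le_antisymm ?_ (MeasurableSpace.generateFrom_mono ?_)
    · rw [← borel_cantorTop]
      exact MeasurableSpace.generateFrom_mono fun _ hU => ScottOpen.isOpen_cantorTop hU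
    · rintro _ ⟨h, rfl⟩
      exact scottOpen_setOf_mem h
  refine ⟨fun _ hU => hU.isOpen_cantorTop, ?_, hscott.trans (borel_cantorTop H).symm, hscott⟩
  rintro ⟨h⟩
  exact ⟨_, TopologicalSpace.isOpen_generateFrom_of_mem (Or.inr ⟨h, rfl⟩),
    not_scottOpen_setOf_notMem h⟩
end

section
/- Every nonempty ⊑-directed family D of probability measures on (Set H, 𝔅) has a ⊑-supremum: there is a probability measure μ* such that μ*(U) = ⨆_{μ ∈ D} μ(U) for every Scott-open U. Moreover, the Dirac measure δ_∅ at the empty set is a ⊑-least element and the Dirac measure δ_H at the full set H is a ⊑-greatest element among all probability measures on (Set H, 𝔅). -/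
open MeasureTheory Set

/-- The order `μ ⊑ ν` on measures: `μ U ≤ ν U` for every Scott-open `U`. -/
def MeasLE {H : Type*} (μ ν : @Measure (Set H) (scottBorel H)) : Prop :=
  ∀ U : Set (Set H), ScottOpen U → μ U ≤ ν U

namespace ScottOpen

variable {H : Type*}

lemma measurableSet {U : Set (Set H)} (hU : ScottOpen U) : MeasurableSet[scottBorel H] U :=
  MeasurableSpace.measurableSet_generateFrom hU

lemma exists_finset_mem {U : Set (Set H)} (hU : ScottOpen U) {a : Set H} (ha : a ∈ U) :
    ∃ b : Finset H, (b : Set H) ∈ U ∧ (b : Set H) ⊆ a := by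
  classical
  obtain ⟨_, ⟨b, hb, rfl⟩, hbU⟩ := hU.2 ((fun b : Finset H => (b : Set H)) '' {b | (b : Set H) ⊆ a})
    ⟨_, ∅, by simp, rfl⟩
    (by
      rintro _ ⟨b, hb, rfl⟩ _ ⟨c, hc, rfl⟩
      exact ⟨_, ⟨b ∪ c, by simpa using ⟨hb, hc⟩, rfl⟩, by simp, by simp⟩)
    (by
      convert ha
      ext h
      simp only [sUnion_image, mem_ofPred_eq, mem_iUnion, Finset.mem_coe, exists_prop]
      exact ⟨fun ⟨b, hb, hh⟩ => hb hh, fun hh => ⟨{h}, by simpa using hh, by simp⟩⟩)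
  exact ⟨b, hbU, hb⟩

lemma setOf_finset_subset (b : Finset H) : ScottOpen {c : Set H | (b : Set H) ⊆ c} := by
  refine ⟨fun _ _ hac hb => Subset.trans hb hac, fun D hne hD hb => ?_⟩
  obtain ⟨c, hcD, hc⟩ := DirectedOn.exists_mem_subset_of_finset_subset_biUnion
    (f := id) hne hD (s := b) (by simpa [sUnion_eq_biUnion] using hb)
  exact ⟨c, hcD, hc⟩

lemma iUnion {ι : Sort*} {U : ι → Set (Set H)} (hU : ∀ i, ScottOpen (U i)) :
    ScottOpen (⋃ i, U i) := by
  refine ⟨fun a b hab ha => ?_, fun D hne hD hDU => ?_⟩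
  · obtain ⟨i, hi⟩ := mem_iUnion.1 ha
    exact mem_iUnion.2 ⟨i, (hU i).1 hab hi⟩
  · obtain ⟨i, hi⟩ := mem_iUnion.1 hDU
    obtain ⟨c, hcD, hc⟩ := (hU i).2 D hne hD hi
    exact ⟨c, hcD, mem_iUnion.2 ⟨i, hc⟩⟩

lemma eq_univ_of_empty_mem {U : Set (Set H)} (hU : ScottOpen U) (h : ∅ ∈ U) : U = univ :=
  eq_univ_of_forall fun _ => hU.1 (empty_subset _) h

end ScottOpen

section Cantor

variable {H : Type*}

/-- The union of the basic Scott-open sets `{c | b ⊆ c}` over those `b ∈ F` that belong to `U`. -/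
def scottApprox (U : Set (Set H)) (F : Finset (Finset H)) : Set (Set H) :=
  ⋃ b ∈ F, ⋃ _ : (b : Set H) ∈ U, {c : Set H | (b : Set H) ⊆ c}

lemma scottOpen_scottApprox (U : Set (Set H)) (F : Finset (Finset H)) :
    ScottOpen (scottApprox U F) :=
  .iUnion fun b => .iUnion fun _ => .iUnion fun _ => .setOf_finset_subset b

lemma monotone_scottApprox (U : Set (Set H)) : Monotone (scottApprox U) :=
  fun _ _ hFG => biUnion_subset_biUnion_left hFG

lemma ScottOpen.iUnion_scottApprox {U : Set (Set H)} (hU : ScottOpen U) :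
    ⋃ F, scottApprox U F = U := by
  ext a
  simp only [scottApprox, mem_iUnion, mem_ofPred_eq, exists_prop]
  constructor
  · rintro ⟨F, b, -, hb, hba⟩
    exact hU.1 hba hb
  · intro ha
    obtain ⟨b, hb, hba⟩ := hU.exists_finset_mem ha
    exact ⟨{b}, b, by simp, hb, hba⟩

lemma ScottOpen.measure_eq_iSup [Countable H] {U : Set (Set H)} (hU : ScottOpen U)
    (μ : @Measure (Set H) (scottBorel H)) : μ U = ⨆ F, μ (scottApprox U F) := by
  conv_lhs => rw [← hU.iUnion_scottApprox]
  exact (monotone_scottApprox U).directed_le.measure_iUnion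

/-- The set of coordinates at which a point of the Cantor space is `true`. -/
def trueSet (x : H → Bool) : Set H := {h | x h = true}

lemma isClopen_preimage_trueSet_scottApprox (U : Set (Set H)) (F : Finset (Finset H)) :
    IsClopen (trueSet ⁻¹' scottApprox U F) := by
  simp only [scottApprox, preimage_iUnion]
  refine F.finite_toSet.isClopen_biUnion fun b _ => ?_
  refine isClopen_iUnion_of_finite fun _ => ?_
  have : trueSet ⁻¹' {c : Set H | (b : Set H) ⊆ c} =
      ⋂ h ∈ b, (fun x : H → Bool => x h) ⁻¹' {true} := by
    ext x; simp [trueSet, subset_def]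
  rw [this]
  exact isClopen_biInter_finset fun h _ => (isClopen_discrete {true}).preimage (continuous_apply h)

lemma measurable_trueSet [Countable H] :
    @Measurable (H → Bool) (Set H) _ (scottBorel H) trueSet := by
  refine measurable_generateFrom fun U hU => ?_
  rw [← ScottOpen.iUnion_scottApprox hU, preimage_iUnion]
  exact .iUnion fun F => (isClopen_preimage_trueSet_scottApprox U F).isOpen.measurableSet

open Classical in
lemma exists_measurable_trueSet_comp_eq (H : Type*) : ∃ e : Set H → H → Bool,
    @Measurable (Set H) (H → Bool) (scottBorel H) _ e ∧ ∀ c, trueSet (e c) = c := by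
  refine ⟨fun c h => decide (h ∈ c), ?_, fun c => by ext; simp [trueSet]⟩
  let _ := scottBorel H
  refine measurable_pi_lambda _ fun h => measurable_to_bool ?_
  convert (ScottOpen.setOf_finset_subset {h}).measurableSet using 1
  ext c; simp

end Cantor

lemma exists_tendsto_of_isClopen {X ι : Type*} [TopologicalSpace X] [CompactSpace X] [T2Space X]
    [SecondCountableTopology X] [MeasurableSpace X] [BorelSpace X] (l : Filter ι) [l.NeBot]
    (μs : ι → ProbabilityMeasure X) : ∃ (μ : ProbabilityMeasure X) (l' : Filter ι), l'.NeBot ∧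
      l' ≤ l ∧ ∀ E, IsClopen E →
        Filter.Tendsto (fun i => (μs i : Measure X) E) l' (nhds ((μ : Measure X) E)) := by
  let _ := TopologicalSpace.metrizableSpaceMetric X
  obtain ⟨μ, -, hμ⟩ := isCompact_univ.ultrafilter_le_nhds ((Ultrafilter.of l).map μs) (by simp)
  refine ⟨μ, Ultrafilter.of l, inferInstance, Ultrafilter.of_le l, fun E hE => ?_⟩
  exact ProbabilityMeasure.tendsto_measure_of_null_frontier_of_tendsto' hμ (by simp [hE.frontier_eq])

lemma exists_measure_eq_iSup_of_directed {H ι : Type*} [Countable H] [Preorder ι]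
    [IsDirectedOrder ι] [Nonempty ι] (μs : ι → @Measure (Set H) (scottBorel H))
    (hprob : ∀ i, @IsProbabilityMeasure (Set H) (scottBorel H) (μs i))
    (hmono : ∀ ⦃i j⦄, i ≤ j → MeasLE (μs i) (μs j)) :
    ∃ μstar : @Measure (Set H) (scottBorel H),
      @IsProbabilityMeasure (Set H) (scottBorel H) μstar ∧
      ∀ U : Set (Set H), ScottOpen U → μstar U = ⨆ i, μs i U := by
  let _ := scottBorel H
  obtain ⟨e, he, hec⟩ := exists_measurable_trueSet_comp_eq H
  obtain ⟨ν, l, hl, hle, hν⟩ := exists_tendsto_of_isClopen Filter.atTop fun i =>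
    (⟨(μs i).map e, Measure.isProbabilityMeasure_map he.aemeasurable⟩ :
      ProbabilityMeasure (H → Bool))
  refine ⟨(ν : Measure (H → Bool)).map trueSet,
    Measure.isProbabilityMeasure_map measurable_trueSet.aemeasurable, fun U hU => ?_⟩
  have key (F : Finset (Finset H)) : (ν : Measure (H → Bool)).map trueSet (scottApprox U F) =
      ⨆ i, μs i (scottApprox U F) := by
    have hF := scottOpen_scottApprox U F
    rw [Measure.map_apply measurable_trueSet hF.measurableSet]
    refine tendsto_nhds_unique (hν _ (isClopen_preimage_trueSet_scottApprox U F)) ?_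
    have hF_mono : Monotone fun i => μs i (scottApprox U F) := fun _ _ h => hmono h _ hF
    refine ((tendsto_atTop_iSup hF_mono).mono_left hle).congr fun i => ?_
    simp only [ProbabilityMeasure.coe_mk]
    rw [Measure.map_apply he (measurable_trueSet hF.measurableSet), ← preimage_comp]
    simp [hec, Function.comp_def]
  simp_rw [hU.measure_eq_iSup, key]
  rw [iSup_comm]

lemma DirectedOn.exists_measure_eq_biSup {H : Type*} [Countable H]
    {D : Set (@Measure (Set H) (scottBorel H))} (hdir : DirectedOn MeasLE D) (hne : D.Nonempty)
    (hprob : ∀ μ ∈ D, @IsProbabilityMeasure (Set H) (scottBorel H) μ) :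
    ∃ μstar : @Measure (Set H) (scottBorel H),
      @IsProbabilityMeasure (Set H) (scottBorel H) μstar ∧
      ∀ U : Set (Set H), ScottOpen U → μstar U = ⨆ μ ∈ D, μ U := by
  let P : Preorder D :=
    { le := fun μ ν => MeasLE μ.1 ν.1
      lt := fun μ ν => MeasLE μ.1 ν.1 ∧ ¬ MeasLE ν.1 μ.1
      le_refl := fun _ _ _ => le_rfl
      le_trans := fun _ _ _ h h' U hU => (h U hU).trans (h' U hU)
      lt_iff_le_not_ge := fun _ _ => Iff.rfl }
  have hP : @IsDirectedOrder D P.toLE := ⟨fun μ ν =>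
    let ⟨ρ, hρ, h₁, h₂⟩ := hdir μ μ.2 ν ν.2
    ⟨⟨ρ, hρ⟩, h₁, h₂⟩⟩
  simp_rw [← iSup_subtype'']
  exact @exists_measure_eq_iSup_of_directed H D _ P hP hne.to_subtype Subtype.val
    (fun μ => hprob μ μ.2) fun _ _ h => h

lemma dirac_empty_measLE {H : Type*} (μ : @Measure (Set H) (scottBorel H))
    (hμ : @IsProbabilityMeasure (Set H) (scottBorel H) μ) :
    MeasLE (@Measure.dirac (Set H) (scottBorel H) ∅) μ := by
  let _ := scottBorel H
  intro U hU
  rw [Measure.dirac_apply' _ hU.measurableSet]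
  by_cases h : ∅ ∈ U
  · simp [hU.eq_univ_of_empty_mem h]
  · simp [h]

lemma measLE_dirac_univ {H : Type*} (μ : @Measure (Set H) (scottBorel H))
    (hμ : @IsProbabilityMeasure (Set H) (scottBorel H) μ) :
    MeasLE μ (@Measure.dirac (Set H) (scottBorel H) univ) := by
  let _ := scottBorel H
  intro U hU
  obtain rfl | ⟨a, ha⟩ := U.eq_empty_or_nonempty
  · simp
  · rw [Measure.dirac_apply' _ hU.measurableSet, indicator_of_mem (hU.1 (subset_univ a) ha)]
    exact prob_le_one

/-- Every nonempty `⊑`-directed family of probability measures has a `⊑`-supremum;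
moreover `δ_∅` is `⊑`-least and `δ_H` is `⊑`-greatest among probability measures. -/
theorem directed_sup_exists_and_bot_top {H : Type*} [Countable H]
    (D : Set (@Measure (Set H) (scottBorel H))) (hne : D.Nonempty)
    (hprob : ∀ μ ∈ D, @IsProbabilityMeasure (Set H) (scottBorel H) μ)
    (hdir : DirectedOn MeasLE D) :
    (∃ μstar : @Measure (Set H) (scottBorel H),
        @IsProbabilityMeasure (Set H) (scottBorel H) μstar ∧
        ∀ U : Set (Set H), ScottOpen U → μstar U = ⨆ μ ∈ D, μ U) ∧
    (∀ μ : @Measure (Set H) (scottBorel H),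
        @IsProbabilityMeasure (Set H) (scottBorel H) μ →
        MeasLE (@Measure.dirac (Set H) (scottBorel H) (∅ : Set H)) μ ∧
        MeasLE μ (@Measure.dirac (Set H) (scottBorel H) (Set.univ : Set H))) := by
  exact ⟨hdir.exists_measure_eq_biSup hne hprob,
    fun μ hμ => ⟨dirac_empty_measLE μ hμ, measLE_dirac_univ μ hμ⟩⟩
end

section
/- Let f : Set H → ℝ≥0∞ be Scott-continuous, i.e. monotone with respect to ⊆ and satisfying f(⋃ D) = ⨆_{a ∈ D} f(a) for every nonempty directed family D of subsets of H (such an f is Borel measurable). Then the Lebesgue integral is Scott-continuous in the measure: (a) if μ ⊑ ν then ∫⁻ f dμ ≤ ∫⁻ f dν; and (b) if D is a nonempty ⊑-directed family of probability measures with ⊑-supremum μ*, then ∫⁻ f dμ* = ⨆_{μ ∈ D} ∫⁻ f dμ. -/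
open MeasureTheory Set ENNReal

/-- A function `f : Set H → ℝ≥0∞` is Scott-continuous if it is monotone with respect
to `⊆` and preserves suprema of nonempty directed families. -/
def ScottCont {H : Type*} (f : Set H → ℝ≥0∞) : Prop :=
  Monotone f ∧
  ∀ D : Set (Set H), D.Nonempty → DirectedOn (· ⊆ ·) D → f (⋃₀ D) = ⨆ a ∈ D, f a

/-- The approximation from below of a function by a multiple of the number of superlevel sets
`{y | (k + 1) / N < f y}`, `k < N * N`, that contain a given point. -/
noncomputable def lowerStaircase {α : Type*} (f : α → ℝ≥0∞) (N : ℕ) (x : α) : ℝ≥0∞ :=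
  (N : ℝ≥0∞)⁻¹ * ∑ k ∈ Finset.range (N * N),
    indicator {y | ((k : ℝ≥0∞) + 1) / N < f y} 1 x

theorem sum_range_ite_succ_lt_le (M : ℝ≥0∞) (K : ℕ) :
    ∑ k ∈ Finset.range K, (if (k : ℝ≥0∞) + 1 < M then (1 : ℝ≥0∞) else 0) ≤ M := by
  induction K with
  | zero => simp
  | succ K ih =>
    by_cases h : (K : ℝ≥0∞) + 1 < M
    · calc ∑ k ∈ Finset.range (K + 1), (if (k : ℝ≥0∞) + 1 < M then (1 : ℝ≥0∞) else 0)
          ≤ ∑ k ∈ Finset.range (K + 1), 1 := Finset.sum_le_sum fun k _ => by split_ifs <;> simp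
        _ = (K : ℝ≥0∞) + 1 := by simp
        _ ≤ M := h.le
    · rw [Finset.sum_range_succ, if_neg h, add_zero]
      exact ih

theorem le_sum_range_ite_succ_lt {M : ℝ≥0∞} {j K : ℕ} (hjK : j ≤ K) (hj : (j : ℝ≥0∞) < M) :
    (j : ℝ≥0∞) ≤ ∑ k ∈ Finset.range K, (if (k : ℝ≥0∞) + 1 < M then (1 : ℝ≥0∞) else 0) := by
  calc (j : ℝ≥0∞)
      = ∑ k ∈ Finset.range j, (if (k : ℝ≥0∞) + 1 < M then (1 : ℝ≥0∞) else 0) := by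
        rw [Finset.sum_congr rfl fun k hk => if_pos ?_]
        · simp
        · refine lt_of_le_of_lt ?_ hj
          exact_mod_cast Nat.succ_le_of_lt (Finset.mem_range.1 hk)
    _ ≤ _ := Finset.sum_le_sum_of_subset (Finset.range_mono hjK)

section Staircase

variable {α : Type*} (f : α → ℝ≥0∞)

theorem lowerStaircase_eq {N : ℕ} (hN : N ≠ 0) (x : α) :
    lowerStaircase f N x = (N : ℝ≥0∞)⁻¹ * ∑ k ∈ Finset.range (N * N),
      (if (k : ℝ≥0∞) + 1 < f x * N then (1 : ℝ≥0∞) else 0) := by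
  classical
  have h0 : (N : ℝ≥0∞) ≠ 0 := by exact_mod_cast hN
  simp only [lowerStaircase, indicator_apply, mem_ofPred_eq, Pi.one_apply,
    ENNReal.div_lt_iff (Or.inl h0) (Or.inl (natCast_ne_top N))]

theorem lowerStaircase_le (N : ℕ) (x : α) : lowerStaircase f N x ≤ f x := by
  rcases eq_or_ne N 0 with rfl | hN
  · simp [lowerStaircase]
  rw [lowerStaircase_eq f hN, mul_comm, ← div_eq_mul_inv]
  exact ENNReal.div_le_of_le_mul (sum_range_ite_succ_lt_le _ _)

theorem le_liminf_lowerStaircase (x : α) :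
    f x ≤ Filter.liminf (fun N => lowerStaircase f N x) Filter.atTop := by
  refine le_of_forall_lt fun c hc => ?_
  obtain ⟨a, hca, haf⟩ := ENNReal.lt_iff_exists_nnreal_btwn.1 hc
  obtain ⟨b, hab, hbf⟩ := ENNReal.lt_iff_exists_nnreal_btwn.1 haf
  refine hca.trans_le (Filter.le_liminf_of_le (by isBoundedDefault) ?_)
  have hab' : (a : ℝ) < b := by exact_mod_cast hab
  have hd : (0 : ℝ) < b - a := sub_pos.2 hab'
  filter_upwards [Filter.eventually_ge_atTop (max 1 (max ⌈(b : ℝ)⌉₊ ⌈1 / ((b : ℝ) - a)⌉₊))]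
    with N hN
  simp only [max_le_iff, Nat.ceil_le] at hN
  obtain ⟨hN1, hNb, hNd⟩ := hN
  have hN0 : (0 : ℝ) < N := by exact_mod_cast hN1
  rw [div_le_iff₀ hd] at hNd
  have hceil : (⌈(a : ℝ) * N⌉₊ : ℝ) < a * N + 1 := Nat.ceil_lt_add_one (by positivity)
  have hjb : (⌈(a : ℝ) * N⌉₊ : ℝ) < b * N := by nlinarith
  have hjK : ⌈(a : ℝ) * N⌉₊ ≤ N * N := by
    have : (⌈(a : ℝ) * N⌉₊ : ℝ) ≤ N * N := by nlinarith
    exact_mod_cast this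
  have hjM : ((⌈(a : ℝ) * N⌉₊ : ℕ) : ℝ≥0∞) < f x * N := by
    calc ((⌈(a : ℝ) * N⌉₊ : ℕ) : ℝ≥0∞) < b * N := by exact_mod_cast hjb
      _ ≤ f x * N := by gcongr
  have haj : (a : ℝ≥0∞) * N ≤ (⌈(a : ℝ) * N⌉₊ : ℕ) := by
    have : (a : ℝ) * N ≤ (⌈(a : ℝ) * N⌉₊ : ℕ) := Nat.le_ceil _
    exact_mod_cast this
  rw [lowerStaircase_eq f (by omega), mul_comm, ← div_eq_mul_inv,
    ENNReal.le_div_iff_mul_le (Or.inl (by exact_mod_cast hN0.ne'))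
      (Or.inl (natCast_ne_top N))]
  exact haj.trans (le_sum_range_ite_succ_lt hjK hjM)

variable {f} [MeasurableSpace α]

theorem measurable_lowerStaircase (hf : Measurable f) (N : ℕ) :
    Measurable (lowerStaircase f N) :=
  (Finset.measurable_fun_sum _ fun _ _ =>
    measurable_one.indicator (measurableSet_lt measurable_const hf)).const_mul _

theorem lintegral_lowerStaircase (hf : Measurable f) (μ : Measure α) (N : ℕ) :
    ∫⁻ x, lowerStaircase f N x ∂μ = (N : ℝ≥0∞)⁻¹ *
      ∑ k ∈ Finset.range (N * N), μ {y | ((k : ℝ≥0∞) + 1) / N < f y} := by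
  have hm (k : ℕ) : MeasurableSet {y | ((k : ℝ≥0∞) + 1) / N < f y} :=
    measurableSet_lt measurable_const hf
  simp only [lowerStaircase]
  rw [lintegral_const_mul _ (Finset.measurable_fun_sum _ fun k _ =>
      measurable_one.indicator (hm k)),
    lintegral_finsetSum _ fun k _ => measurable_one.indicator (hm k)]
  simp only [lintegral_indicator_one (hm _)]

theorem lintegral_le_of_forall_lowerStaircase_le (hf : Measurable f) {μ : Measure α} {L : ℝ≥0∞}
    (h : ∀ N, ∫⁻ x, lowerStaircase f N x ∂μ ≤ L) : ∫⁻ x, f x ∂μ ≤ L :=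
  calc ∫⁻ x, f x ∂μ
      ≤ ∫⁻ x, Filter.liminf (fun N => lowerStaircase f N x) Filter.atTop ∂μ :=
        lintegral_mono (le_liminf_lowerStaircase f)
    _ ≤ Filter.liminf (fun N => ∫⁻ x, lowerStaircase f N x ∂μ) Filter.atTop :=
        lintegral_liminf_le (measurable_lowerStaircase hf)
    _ ≤ L := Filter.liminf_le_of_le (by isBoundedDefault) fun b hb =>
        let ⟨N, hN⟩ := hb.exists
        hN.trans (h N)

theorem lintegral_mono_of_measure_superlevel_le (hf : Measurable f) {μ ν : Measure α}
    (h : ∀ c, μ {x | c < f x} ≤ ν {x | c < f x}) : ∫⁻ x, f x ∂μ ≤ ∫⁻ x, f x ∂ν := by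
  refine lintegral_le_of_forall_lowerStaircase_le hf fun N => ?_
  refine le_trans ?_ (lintegral_mono (lowerStaircase_le f N))
  rw [lintegral_lowerStaircase hf, lintegral_lowerStaircase hf]
  exact mul_le_mul_right (Finset.sum_le_sum fun k _ => h _) _

theorem lintegral_eq_iSup_of_measure_superlevel_eq_iSup (hf : Measurable f) {ι : Type*}
    {μ : ι → Measure α} {ν : Measure α}
    (hdir : ∀ i j, ∃ k, ∀ c, μ i {x | c < f x} ≤ μ k {x | c < f x} ∧
      μ j {x | c < f x} ≤ μ k {x | c < f x})
    (h : ∀ c, ν {x | c < f x} = ⨆ i, μ i {x | c < f x}) :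
    ∫⁻ x, f x ∂ν = ⨆ i, ∫⁻ x, f x ∂μ i := by
  refine le_antisymm (lintegral_le_of_forall_lowerStaircase_le hf fun N => ?_)
    (iSup_le fun i => lintegral_mono_of_measure_superlevel_le hf fun c => ?_)
  · rw [lintegral_lowerStaircase hf]
    simp only [h]
    rw [ENNReal.finsetSum_iSup (f := fun (k : ℕ) i => μ i {y | ((k : ℝ≥0∞) + 1) / N < f y})
      fun i j => (hdir i j).imp fun k hk c => hk _, ENNReal.mul_iSup]
    refine iSup_mono fun i => ?_
    rw [← lintegral_lowerStaircase hf]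
    exact lintegral_mono (lowerStaircase_le f N)
  · rw [h]
    exact le_iSup (fun i => μ i {x | c < f x}) i

end Staircase

theorem ScottCont.scottOpen_superlevel {H : Type*} {f : Set H → ℝ≥0∞} (hf : ScottCont f)
    (c : ℝ≥0∞) : ScottOpen {x | c < f x} := by
  refine ⟨fun a b hab ha => lt_of_lt_of_le ha (hf.1 hab), fun D hne hD hc => ?_⟩
  rw [mem_ofPred_eq, hf.2 D hne hD] at hc
  obtain ⟨a, ha⟩ := lt_iSup_iff.1 hc
  obtain ⟨haD, ha⟩ := lt_iSup_iff.1 ha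
  exact ⟨a, haD, ha⟩

theorem ScottCont.measurable {H : Type*} {f : Set H → ℝ≥0∞} (hf : ScottCont f) :
    @Measurable _ _ (scottBorel H) _ f :=
  letI := scottBorel H
  measurable_of_Ioi fun c =>
    MeasurableSpace.measurableSet_generateFrom (hf.scottOpen_superlevel c)

/-- Lebesgue integration of a Scott-continuous function is Scott-continuous in the
measure: monotone with respect to `⊑`, and preserving `⊑`-suprema of nonempty
`⊑`-directed families of probability measures. -/
theorem lintegral_scottCont_mono_and_sup {H : Type*} [Countable H]
    (f : Set H → ℝ≥0∞) (hf : ScottCont f) :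
    (∀ μ ν : @Measure (Set H) (scottBorel H),
      @IsProbabilityMeasure (Set H) (scottBorel H) μ →
      @IsProbabilityMeasure (Set H) (scottBorel H) ν →
      MeasLE μ ν → MeasureTheory.lintegral μ f ≤ MeasureTheory.lintegral ν f) ∧
    (∀ (D : Set (@Measure (Set H) (scottBorel H))) (μstar : @Measure (Set H) (scottBorel H)),
      D.Nonempty → (∀ μ ∈ D, @IsProbabilityMeasure (Set H) (scottBorel H) μ) →
      DirectedOn MeasLE D →
      @IsProbabilityMeasure (Set H) (scottBorel H) μstar →
      (∀ U : Set (Set H), ScottOpen U → μstar U = ⨆ μ ∈ D, μ U) →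
      MeasureTheory.lintegral μstar f = ⨆ μ ∈ D, MeasureTheory.lintegral μ f) := by
  refine ⟨fun μ ν _ _ h => @lintegral_mono_of_measure_superlevel_le _ _ (scottBorel H) hf.measurable
    μ ν fun c => h _ (hf.scottOpen_superlevel c), fun D μstar _ _ hD _ h => ?_⟩
  rw [iSup_subtype']
  refine @lintegral_eq_iSup_of_measure_superlevel_eq_iSup _ _ (scottBorel H) hf.measurable D
    (fun μ => μ) μstar (fun μ ν => ?_) fun c => ?_
  · obtain ⟨ρ, hρ, hμ, hν⟩ := hD μ μ.2 ν ν.2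
    exact ⟨⟨ρ, hρ⟩, fun c => ⟨hμ _ (hf.scottOpen_superlevel c), hν _ (hf.scottOpen_superlevel c)⟩⟩
  · rw [h _ (hf.scottOpen_superlevel c), iSup_subtype']
end

section
/- Let f : Set H → ℝ≥0∞ be Scott-continuous, i.e. monotone with respect to ⊆ and satisfying f(⋃ D) = ⨆_{a ∈ D} f(a) for every nonempty directed family D of subsets of H, and let μ be a probability measure on (Set H, 𝔅). Then ∫⁻ f dμ = ⨆ { ∫⁻ g dμ : g is 𝒪-simple and g ≤ f pointwise }, where a function g : Set H → ℝ≥0∞ is 𝒪-simple if it is a finite sum g = ∑_{i=1}^k r_i · 1_{A_i} with each A_i Scott-open and each r_i ∈ ℝ≥0∞. -/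
open MeasureTheory Set ENNReal

/-- A function is `𝒪`-simple if it is a finite linear combination of indicator
functions of Scott-open sets. -/
def OSimple {H : Type*} (g : Set H → ℝ≥0∞) : Prop :=
  ∃ (k : ℕ) (r : Fin k → ℝ≥0∞) (A : Fin k → Set (Set H)),
    (∀ i, ScottOpen (A i)) ∧ g = fun c => ∑ i, (A i).indicator (fun _ => r i) c

/-- The staircase approximation of `f` from below with `(n + 1) ^ 2` steps of height
`1 / (n + 1)`. -/
noncomputable def staircase {α : Type*} (f : α → ℝ≥0∞) (n : ℕ) (c : α) : ℝ≥0∞ :=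
  ∑ k : Fin ((n + 1) ^ 2),
    {x | ((k + 1 : ℕ) : ℝ≥0∞) * ((n + 1 : ℕ) : ℝ≥0∞)⁻¹ < f x}.indicator
      (fun _ => ((n + 1 : ℕ) : ℝ≥0∞)⁻¹) c

theorem sum_range_ite_lt_le (N : ℕ) (e t : ℝ≥0∞) :
    ∑ k ∈ Finset.range N, (if ((k + 1 : ℕ) : ℝ≥0∞) * e < t then e else 0) ≤ t := by
  induction N with
  | zero => simp
  | succ N ih =>
    rw [Finset.sum_range_succ]
    split_ifs with h
    · calc _ ≤ ∑ k ∈ Finset.range N, e + e := by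
            gcongr
            split_ifs <;> simp
        _ = ((N + 1 : ℕ) : ℝ≥0∞) * e := by simp [add_mul]
        _ ≤ t := h.le
    · simpa using ih

theorem staircase_eq_sum_range {α : Type*} (f : α → ℝ≥0∞) (n : ℕ) (c : α) :
    staircase f n c = ∑ k ∈ Finset.range ((n + 1) ^ 2),
      (if ((k + 1 : ℕ) : ℝ≥0∞) * ((n + 1 : ℕ) : ℝ≥0∞)⁻¹ < f c
        then ((n + 1 : ℕ) : ℝ≥0∞)⁻¹ else 0) := by
  rw [Finset.sum_range]
  simp only [staircase, indicator_apply, mem_ofPred_eq]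

theorem staircase_le {α : Type*} (f : α → ℝ≥0∞) (n : ℕ) : staircase f n ≤ f := fun c => by
  rw [staircase_eq_sum_range]
  exact sum_range_ite_lt_le _ _ _

theorem eventually_le_staircase {α : Type*} (f : α → ℝ≥0∞) (c : α) {a : ℝ≥0∞} (ha : a < f c) :
    ∀ᶠ n in Filter.atTop, a ≤ staircase f n c := by
  obtain ⟨b, hab, hbf⟩ := ENNReal.lt_iff_exists_nnreal_btwn.1 ha
  lift a to NNReal using hab.ne_top
  have hab' : (a : ℝ) < b := by exact_mod_cast hab
  obtain ⟨m, hm⟩ := exists_nat_gt (max (a : ℝ) (1 / (b - a)))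
  filter_upwards [Filter.eventually_ge_atTop m] with n hn
  have hn' : (m : ℝ) ≤ n := by exact_mod_cast hn
  have h_an : (a : ℝ) ≤ n + 1 := by linarith [le_max_left (a : ℝ) (1 / (b - a))]
  have h_ban : 1 ≤ ((n : ℝ) + 1) * (b - a) := by
    have h : 1 / ((b : ℝ) - a) ≤ n + 1 := by linarith [le_max_right (a : ℝ) (1 / (b - a))]
    rwa [div_le_iff₀ (by linarith)] at h
  set K := ⌈(a : ℝ) * (n + 1)⌉₊ with hK
  have h_Kn : K ≤ (n + 1) ^ 2 := by
    rw [hK, Nat.ceil_le]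
    push_cast
    nlinarith
  have h_aK : (a : ℝ) * (n + 1) ≤ K := Nat.le_ceil _
  have h_Kb : (K : ℝ) ≤ b * (n + 1) := by
    have := Nat.ceil_lt_add_one (a := (a : ℝ) * (n + 1)) (by positivity)
    nlinarith
  have h_ne : ((n + 1 : ℕ) : ℝ≥0∞) ≠ 0 := by simp
  have h_top : ((n + 1 : ℕ) : ℝ≥0∞) ≠ ∞ := natCast_ne_top _
  rw [staircase_eq_sum_range]
  calc (a : ℝ≥0∞) ≤ K * ((n + 1 : ℕ) : ℝ≥0∞)⁻¹ := by
        rw [← div_eq_mul_inv, ENNReal.le_div_iff_mul_le (.inl h_ne) (.inl h_top)]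
        exact_mod_cast h_aK
    _ = ∑ k ∈ Finset.range K, ((n + 1 : ℕ) : ℝ≥0∞)⁻¹ := by simp
    _ = ∑ k ∈ Finset.range K, (if ((k + 1 : ℕ) : ℝ≥0∞) * ((n + 1 : ℕ) : ℝ≥0∞)⁻¹ < f c
        then ((n + 1 : ℕ) : ℝ≥0∞)⁻¹ else 0) := by
        refine Finset.sum_congr rfl fun k hk => (if_pos (lt_of_le_of_lt ?_ hbf)).symm
        rw [← div_eq_mul_inv, ENNReal.div_le_iff_le_mul (.inl h_ne) (.inl h_top)]
        have hkK : ((k + 1 : ℕ) : ℝ) ≤ K := by exact_mod_cast Finset.mem_range.1 hk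
        exact_mod_cast hkK.trans h_Kb
    _ ≤ _ := Finset.sum_le_sum_of_subset (Finset.range_subset_range.2 h_Kn)

theorem le_liminf_staircase {α : Type*} (f : α → ℝ≥0∞) (c : α) :
    f c ≤ Filter.liminf (fun n => staircase f n c) Filter.atTop :=
  le_of_forall_lt fun _ ha =>
    let ⟨_, hab, hbf⟩ := exists_between ha
    hab.trans_le (Filter.le_liminf_of_le (h := eventually_le_staircase f c hbf))

theorem lintegral_le_iSup_lintegral_staircase {α : Type*} [MeasurableSpace α] (μ : Measure α)
    {f : α → ℝ≥0∞} (hf : Measurable f) :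
    ∫⁻ c, f c ∂μ ≤ ⨆ n, ∫⁻ c, staircase f n c ∂μ := by
  have hmeas (n : ℕ) : Measurable (staircase f n) :=
    Finset.measurable_fun_sum _ fun _ _ =>
      measurable_const.indicator (measurableSet_lt measurable_const hf)
  calc ∫⁻ c, f c ∂μ ≤ ∫⁻ c, Filter.liminf (fun n => staircase f n c) Filter.atTop ∂μ :=
        lintegral_mono (le_liminf_staircase f)
    _ ≤ Filter.liminf (fun n => ∫⁻ c, staircase f n c ∂μ) Filter.atTop :=
        lintegral_liminf_le hmeas
    _ ≤ ⨆ n, ∫⁻ c, staircase f n c ∂μ :=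
        (Filter.liminf_le_limsup).trans Filter.limsup_le_iSup

theorem ScottCont.scottOpen_lt {H : Type*} {f : Set H → ℝ≥0∞} (hf : ScottCont f) (s : ℝ≥0∞) :
    ScottOpen {c | s < f c} := by
  refine ⟨fun a b hab ha => lt_of_lt_of_le ha (hf.1 hab), fun D hD hdir hs => ?_⟩
  rw [mem_ofPred_eq, hf.2 D hD hdir] at hs
  simp only [lt_iSup_iff] at hs
  obtain ⟨a, haD, ha⟩ := hs
  exact ⟨a, haD, ha⟩

theorem ScottCont.oSimple_staircase {H : Type*} {f : Set H → ℝ≥0∞} (hf : ScottCont f) (n : ℕ) :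
    OSimple (staircase f n) :=
  ⟨_, _, _, fun _ => hf.scottOpen_lt _, rfl⟩

/-- The integral of a Scott-continuous function is the supremum of the integrals of the
`𝒪`-simple functions below it. -/
theorem lintegral_eq_iSup_osimple {H : Type*} [Countable H]
    (f : Set H → ℝ≥0∞) (hf : ScottCont f)
    (μ : @Measure (Set H) (scottBorel H))
    (hμ : @IsProbabilityMeasure (Set H) (scottBorel H) μ) :
    MeasureTheory.lintegral μ f =
      ⨆ (g : Set H → ℝ≥0∞) (_ : OSimple g) (_ : g ≤ f), MeasureTheory.lintegral μ g := by
  refine le_antisymm ?_ (iSup_le fun g => iSup₂_le fun _ hg => ?_)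
  · refine (@lintegral_le_iSup_lintegral_staircase _ (scottBorel H) μ f hf.measurable).trans
      (iSup_le fun n => ?_)
    exact le_iSup_of_le (staircase f n)
      (le_iSup₂_of_le (hf.oSimple_staircase n) (staircase_le f n) le_rfl)
  · exact @lintegral_mono _ (scottBorel H) μ _ _ hg
end

section
/- For every probability measure μ on (Set H, 𝔅) and every Scott-open set U ⊆ Set H, the value μ(U) is approximated arbitrarily closely from below by measures of compact-open sets: μ(U) = ⨆ { μ(⋃_{a ∈ F} B_a) : F a finite family of finite subsets of H with ⋃_{a ∈ F} B_a ⊆ U }. -/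
open MeasureTheory Set ENNReal

namespace ScottOpen

/-- Every member of a Scott-open set has a finite subset in that set. -/
theorem exists_finset_subset_mem_s11 {H : Type*} {U : Set (Set H)} (hU : ScottOpen U)
    {c : Set H} (hc : c ∈ U) : ∃ a : Finset H, (a : Set H) ⊆ c ∧ (a : Set H) ∈ U := by
  classical
  obtain ⟨_, ⟨a, hac, rfl⟩, haU⟩ := hU.2
      ((fun a : Finset H => (a : Set H)) '' {a | (a : Set H) ⊆ c})
    ⟨_, ∅, by simp, rfl⟩
    (by
      rintro _ ⟨a, ha, rfl⟩ _ ⟨b, hb, rfl⟩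
      exact ⟨_, ⟨a ∪ b, by simpa using ⟨ha, hb⟩, rfl⟩, by simp, by simp⟩)
    (by
      convert hc using 1
      refine Subset.antisymm (sUnion_subset ?_) fun x hx => ?_
      · rintro _ ⟨a, ha, rfl⟩
        exact ha
      · exact ⟨_, ⟨{x}, by simpa using hx, rfl⟩, by simp⟩)
  exact ⟨a, hac, haU⟩

/-- A Scott-open set is the union of its compact-open subsets. -/
theorem eq_iUnion_compactOpen {H : Type*} {U : Set (Set H)} (hU : ScottOpen U) :
    U = ⋃ F ∈ {F : Finset (Finset H) | (⋃ a ∈ F, Bset (a : Set H)) ⊆ U},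
      ⋃ a ∈ F, Bset (a : Set H) := by
  refine Subset.antisymm (fun c hc => ?_) (iUnion₂_subset fun _ hF => hF)
  obtain ⟨a, hac, haU⟩ := hU.exists_finset_subset_mem_s11 hc
  refine mem_biUnion (x := {a}) ?_ (by simpa [Bset] using hac)
  simpa using show Bset (a : Set H) ⊆ U from fun b hb => hU.1 hb haU

end ScottOpen

/-- The finite families of basic open sets contained in `U` are directed under inclusion of
their unions. -/
theorem directedOn_compactOpen_subset {H : Type*} (U : Set (Set H)) :
    DirectedOn (Function.onFun (· ⊆ ·)
        fun F : Finset (Finset H) => ⋃ a ∈ F, Bset (a : Set H))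
      {F | (⋃ a ∈ F, Bset (a : Set H)) ⊆ U} := by
  classical
  intro F hF G hG
  refine ⟨F ∪ G, ?_, ?_, ?_⟩
  · rw [mem_ofPred_eq, Finset.set_biUnion_union]
    exact union_subset hF hG
  · exact biUnion_subset_biUnion_left fun _ => Finset.mem_union_left G
  · exact biUnion_subset_biUnion_left fun _ => Finset.mem_union_right F

/-- The measure of a Scott-open set is approximated arbitrarily closely from below
by measures of compact-open subsets, i.e. finite unions of sets `B_a` with `a` finite. -/
theorem measure_open_eq_iSup_compactOpen {H : Type*} [Countable H]
    (μ : @Measure (Set H) (scottBorel H))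
    (hμ : @IsProbabilityMeasure (Set H) (scottBorel H) μ)
    (U : Set (Set H)) (hU : ScottOpen U) :
    μ U = ⨆ (F : Finset (Finset H)) (_ : (⋃ a ∈ F, Bset (↑a : Set H)) ⊆ U),
      μ (⋃ a ∈ F, Bset (↑a : Set H)) := by
  conv_lhs => rw [hU.eq_iUnion_compactOpen]
  exact measure_biUnion_eq_iSup (to_countable _) (directedOn_compactOpen_subset U)
end

section
/- The product of measures is Scott-continuous in each argument: for probability measures μ₁, μ₂ on (Set H₁, 𝔅₁) and ν on (Set H₂, 𝔅₂), if μ₁ ⊑ μ₂ then μ₁ × ν ⊑ μ₂ × ν, where on measures on Set H₁ × Set H₂ (with the product σ-algebra) one writes ρ ⊑ ρ' if ρ(W) ≤ ρ'(W) for every Scott-open subset W of the product order; moreover, if D is a nonempty ⊑-directed family of probability measures on Set H₁ with ⊑-supremum μ*, then (μ* × ν)(W) = ⨆_{μ ∈ D} (μ × ν)(W) for every Scott-open W of the product order. -/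
open MeasureTheory Set ENNReal

/-- Scott-open subsets of the product `Set H₁ × Set H₂` with the componentwise
inclusion order: upper sets that meet every directed family whose componentwise
union (the directed supremum) they contain. -/
def ScottOpenProd {H₁ H₂ : Type*} (W : Set (Set H₁ × Set H₂)) : Prop :=
  (∀ ⦃p q : Set H₁ × Set H₂⦄, p.1 ⊆ q.1 → p.2 ⊆ q.2 → p ∈ W → q ∈ W) ∧
  ∀ D : Set (Set H₁ × Set H₂), D.Nonempty →
    DirectedOn (fun p q => p.1 ⊆ q.1 ∧ p.2 ⊆ q.2) D →
    (⋃ p ∈ D, p.1, ⋃ p ∈ D, p.2) ∈ W → (D ∩ W).Nonempty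

/-- The product σ-algebra `𝔅₁ ⊗ 𝔅₂` on `Set H₁ × Set H₂`. -/
def prodBorel (H₁ H₂ : Type*) : MeasurableSpace (Set H₁ × Set H₂) :=
  @Prod.instMeasurableSpace _ _ (scottBorel H₁) (scottBorel H₂)

theorem scottOpen_principal {H : Type*} (b : Finset H) :
    ScottOpen {c : Set H | (b : Set H) ⊆ c} := by
  refine ⟨fun _ _ hab ha => ha.trans hab, fun D hD hdir hb => ?_⟩
  exact hdir.exists_mem_subset_of_finite_of_subset_sUnion hD b.finite_toSet hb

theorem ScottOpen.biUnion {H ι : Type*} {t : Set ι} {U : ι → Set (Set H)}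
    (hU : ∀ i ∈ t, ScottOpen (U i)) : ScottOpen (⋃ i ∈ t, U i) := by
  constructor
  · intro a b hab ha
    simp only [mem_iUnion, exists_prop] at ha ⊢
    obtain ⟨i, hi, ha⟩ := ha
    exact ⟨i, hi, (hU i hi).1 hab ha⟩
  · intro D hD hdir h
    simp only [mem_iUnion, exists_prop] at h
    obtain ⟨i, hi, h⟩ := h
    obtain ⟨d, hd, hdU⟩ := (hU i hi).2 D hD hdir h
    exact ⟨d, hd, mem_biUnion hi hdU⟩

theorem ScottOpenProd.preimage_prodMk {H₁ H₂ : Type*} {W : Set (Set H₁ × Set H₂)}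
    (hW : ScottOpenProd W) (y : Set H₂) : ScottOpen ((fun x => (x, y)) ⁻¹' W) := by
  refine ⟨fun a b hab ha => hW.1 (p := (a, y)) (q := (b, y)) hab Subset.rfl ha,
    fun D hD hdir h => ?_⟩
  suffices h : ((fun x => (x, y)) '' D ∩ W).Nonempty by
    obtain ⟨_, ⟨d, hd, rfl⟩, hdW⟩ := h
    exact ⟨d, hd, hdW⟩
  refine hW.2 _ (hD.image _) ?_ ?_
  · rintro _ ⟨a, ha, rfl⟩ _ ⟨b, hb, rfl⟩
    obtain ⟨c, hc, hac, hbc⟩ := hdir a ha b hb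
    exact ⟨_, ⟨c, hc, rfl⟩, ⟨hac, Subset.rfl⟩, hbc, Subset.rfl⟩
  · simpa only [biUnion_image, biUnion_const hD, ← sUnion_eq_biUnion, mem_preimage] using h

/-- The basic Scott-open rectangle of pairs lying componentwise above `p`. -/
def scottRect {H₁ H₂ : Type*} (p : Finset H₁ × Finset H₂) : Set (Set H₁ × Set H₂) :=
  {c | (p.1 : Set H₁) ⊆ c} ×ˢ {c | (p.2 : Set H₂) ⊆ c}

theorem ScottOpenProd.eq_biUnion_scottRect {H₁ H₂ : Type*} {W : Set (Set H₁ × Set H₂)}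
    (hW : ScottOpenProd W) :
    W = ⋃ p ∈ {p : Finset H₁ × Finset H₂ | ((p.1 : Set H₁), (p.2 : Set H₂)) ∈ W},
      scottRect p := by
  classical
  ext ⟨x, y⟩
  simp only [mem_iUnion, exists_prop]
  constructor
  · intro h
    suffices h : ((fun p : Finset H₁ × Finset H₂ => ((p.1 : Set H₁), (p.2 : Set H₂))) ''
        {p | (p.1 : Set H₁) ⊆ x ∧ (p.2 : Set H₂) ⊆ y} ∩ W).Nonempty by
      obtain ⟨_, ⟨p, ⟨hp₁, hp₂⟩, rfl⟩, hpW⟩ := h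
      exact ⟨p, hpW, hp₁, hp₂⟩
    refine hW.2 _ ⟨_, (∅, ∅), by simp, rfl⟩ ?_ ?_
    · rintro _ ⟨p, hp, rfl⟩ _ ⟨q, hq, rfl⟩
      refine ⟨_, ⟨(p.1 ∪ q.1, p.2 ∪ q.2), ?_, rfl⟩, ?_, ?_⟩
      · simp [hp.1, hp.2, hq.1, hq.2]
      · simp
      · simp
    · refine hW.1 ?_ ?_ h
      · intro a ha
        exact mem_biUnion (mem_image_of_mem _
          (show ({a}, ∅) ∈ {p : Finset H₁ × Finset H₂ | _ ∧ _} by simpa using ha)) (by simp)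
      · intro a ha
        exact mem_biUnion (mem_image_of_mem _
          (show (∅, {a}) ∈ {p : Finset H₁ × Finset H₂ | _ ∧ _} by simpa using ha)) (by simp)
  · rintro ⟨p, hp, hpx, hpy⟩
    exact hW.1 (p := ((p.1 : Set H₁), (p.2 : Set H₂))) (q := (x, y)) hpx hpy hp

/-- Finitely many Scott-open sets can be approximated simultaneously by a member of a
directed family of measures. -/
theorem exists_forall_le_add_of_directedOn {H : Type*}
    {D : Set (@Measure (Set H) (scottBorel H))} {μstar : @Measure (Set H) (scottBorel H)}
    (hD : D.Nonempty) (hdir : DirectedOn MeasLE D)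
    (hfin : @IsFiniteMeasure (Set H) (scottBorel H) μstar)
    (hsup : ∀ U : Set (Set H), ScottOpen U → μstar U = ⨆ μ ∈ D, μ U)
    {ε : ℝ≥0∞} (hε : ε ≠ 0) {F : Set (Set (Set H))} (hF : F.Finite)
    (hopen : ∀ U ∈ F, ScottOpen U) :
    ∃ μ ∈ D, ∀ U ∈ F, μstar U ≤ μ U + ε := by
  induction F, hF using Set.Finite.induction_on with
  | empty => exact ⟨_, hD.some_mem, by simp⟩
  | @insert V F _ _ ih =>
    obtain ⟨μ, hμ, hμF⟩ := ih fun U hU => hopen U (mem_insert_of_mem _ hU)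
    have hV := hopen V (mem_insert _ _)
    obtain ⟨κ, hκ, hκV⟩ : ∃ κ ∈ D, μstar V ≤ κ V + ε := by
      rcases eq_or_ne (μstar V) 0 with h0 | h0
      · exact ⟨μ, hμ, by simp [h0]⟩
      · have hlt : μstar V - ε < ⨆ μ ∈ D, μ V := by
          rw [← hsup V hV]
          exact ENNReal.sub_lt_self (@measure_ne_top _ (scottBorel H) μstar hfin V) h0 hε
        simp only [lt_iSup_iff, exists_prop] at hlt
        obtain ⟨κ, hκ, h⟩ := hlt
        exact ⟨κ, hκ, tsub_le_iff_right.1 h.le⟩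
    obtain ⟨ρ, hρ, hμρ, hκρ⟩ := hdir μ hμ κ hκ
    refine ⟨ρ, hρ, fun U hU => ?_⟩
    rcases hU with rfl | hU
    · exact hκV.trans (add_le_add_left (hκρ _ hV) ε)
    · exact (hμF U hU).trans (add_le_add_left (hμρ _ (hopen U (mem_insert_of_mem _ hU))) ε)

section Product

attribute [local instance] scottBorel

variable {H₁ H₂ : Type*}

theorem ScottOpen.measurableSet_s12 {U : Set (Set H₁)} (hU : ScottOpen U) : MeasurableSet U :=
  MeasurableSpace.measurableSet_generateFrom hU

theorem measurableSet_scottRect (p : Finset H₁ × Finset H₂) : MeasurableSet (scottRect p) :=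
  (scottOpen_principal p.1).measurableSet_s12.prod (scottOpen_principal p.2).measurableSet_s12

theorem ScottOpenProd.measurableSet_s12 [Countable H₁] [Countable H₂]
    {W : Set (Set H₁ × Set H₂)} (hW : ScottOpenProd W) : MeasurableSet W := by
  rw [hW.eq_biUnion_scottRect]
  exact MeasurableSet.biUnion (to_countable _) fun p _ => measurableSet_scottRect p

theorem prod_mono_of_measLE [Countable H₁] [Countable H₂] {μ₁ μ₂ : Measure (Set H₁)}
    [SFinite μ₁] [SFinite μ₂] (ν : Measure (Set H₂)) [SFinite ν] (h : MeasLE μ₁ μ₂)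
    {W : Set (Set H₁ × Set H₂)} (hW : ScottOpenProd W) : μ₁.prod ν W ≤ μ₂.prod ν W := by
  rw [Measure.prod_apply_symm hW.measurableSet_s12, Measure.prod_apply_symm hW.measurableSet_s12]
  exact lintegral_mono fun y => h _ (hW.preimage_prodMk y)

theorem exists_prod_biUnion_scottRect_le_add {D : Set (Measure (Set H₁))}
    {μstar : Measure (Set H₁)} [IsFiniteMeasure μstar] (ν : Measure (Set H₂))
    [IsProbabilityMeasure ν] (hD : D.Nonempty) (hfin : ∀ μ ∈ D, SFinite μ)
    (hdir : DirectedOn MeasLE D)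
    (hsup : ∀ U : Set (Set H₁), ScottOpen U → μstar U = ⨆ μ ∈ D, μ U)
    (t : Finset (Finset H₁ × Finset H₂)) {ε : ℝ≥0∞} (hε : ε ≠ 0) :
    ∃ μ ∈ D, μstar.prod ν (⋃ p ∈ t, scottRect p) ≤ μ.prod ν (⋃ p ∈ t, scottRect p) + ε := by
  classical
  let V : Finset (Finset H₁ × Finset H₂) → Set (Set H₁) := fun s =>
    ⋃ p ∈ (s : Set (Finset H₁ × Finset H₂)), {c : Set H₁ | (p.1 : Set H₁) ⊆ c}
  obtain ⟨μ, hμ, hμV⟩ := exists_forall_le_add_of_directedOn hD hdir inferInstance hsup hε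
    (t.powerset.finite_toSet.image V) (by
      rintro _ ⟨s, -, rfl⟩
      exact ScottOpen.biUnion fun p _ => scottOpen_principal p.1)
  have := hfin μ hμ
  have hmeas : MeasurableSet (⋃ p ∈ t, scottRect p) :=
    t.measurableSet_biUnion fun p _ => measurableSet_scottRect p
  refine ⟨μ, hμ, ?_⟩
  have hsection (y : Set H₂) : (fun x => (x, y)) ⁻¹' (⋃ p ∈ t, scottRect p) =
      V (t.filter fun p => (p.2 : Set H₂) ⊆ y) := by
    ext x
    simp [V, scottRect]
    grind
  rw [Measure.prod_apply_symm hmeas, Measure.prod_apply_symm hmeas]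
  calc ∫⁻ y, μstar ((fun x => (x, y)) ⁻¹' (⋃ p ∈ t, scottRect p)) ∂ν
      ≤ ∫⁻ y, (μ ((fun x => (x, y)) ⁻¹' (⋃ p ∈ t, scottRect p)) + ε) ∂ν := by
        refine lintegral_mono fun y => ?_
        simp only [hsection]
        exact hμV _ (mem_image_of_mem V (Finset.mem_powerset.2 (Finset.filter_subset _ t)))
    _ = ∫⁻ y, μ ((fun x => (x, y)) ⁻¹' (⋃ p ∈ t, scottRect p)) ∂ν + ε := by
        rw [lintegral_add_right _ measurable_const]
        simp

theorem prod_eq_iSup_of_directedOn [Countable H₁] [Countable H₂] {D : Set (Measure (Set H₁))}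
    {μstar : Measure (Set H₁)} [IsFiniteMeasure μstar] (ν : Measure (Set H₂))
    [IsProbabilityMeasure ν] (hD : D.Nonempty) (hfin : ∀ μ ∈ D, SFinite μ)
    (hdir : DirectedOn MeasLE D)
    (hsup : ∀ U : Set (Set H₁), ScottOpen U → μstar U = ⨆ μ ∈ D, μ U)
    {W : Set (Set H₁ × Set H₂)} (hW : ScottOpenProd W) :
    μstar.prod ν W = ⨆ μ ∈ D, μ.prod ν W := by
  classical
  apply le_antisymm
  · set S := {p : Finset H₁ × Finset H₂ | ((p.1 : Set H₁), (p.2 : Set H₂)) ∈ W}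
    have hWS : W = ⋃ t : {t : Finset (Finset H₁ × Finset H₂) // (t : Set _) ⊆ S},
        ⋃ p ∈ t.1, scottRect p := by
      conv_lhs => rw [hW.eq_biUnion_scottRect]
      ext x
      simp only [mem_iUnion, exists_prop, Subtype.exists]
      constructor
      · rintro ⟨p, hp, hx⟩
        exact ⟨{p}, by simpa [S] using hp, p, by simp, hx⟩
      · rintro ⟨t, ht, p, hp, hx⟩
        exact ⟨p, ht hp, hx⟩
    have hdirected : Directed (· ⊆ ·)
        fun t : {t : Finset (Finset H₁ × Finset H₂) // (t : Set _) ⊆ S} =>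
          ⋃ p ∈ t.1, scottRect p := by
      intro s t
      refine ⟨⟨s.1 ∪ t.1, by simp [s.2, t.2]⟩, ?_, ?_⟩
      · exact biUnion_subset_biUnion_left fun p hp => Finset.mem_union_left _ hp
      · exact biUnion_subset_biUnion_left fun p hp => Finset.mem_union_right _ hp
    conv_lhs => rw [hWS, hdirected.measure_iUnion]
    refine iSup_le fun t => ENNReal.le_of_forall_pos_le_add fun ε hε _ => ?_
    obtain ⟨μ, hμ, hle⟩ := exists_prod_biUnion_scottRect_le_add ν hD hfin hdir hsup t.1
      (ENNReal.coe_ne_zero.2 hε.ne')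
    refine hle.trans ?_
    gcongr
    refine le_trans (measure_mono ?_) (le_iSup₂_of_le μ hμ le_rfl)
    conv_rhs => rw [hWS]
    exact subset_iUnion (fun t : {t : Finset (Finset H₁ × Finset H₂) // (t : Set _) ⊆ S} =>
      ⋃ p ∈ t.1, scottRect p) t
  · refine iSup₂_le fun μ hμ => ?_
    have := hfin μ hμ
    refine prod_mono_of_measLE ν (fun U hU => ?_) hW
    rw [hsup U hU]
    exact le_iSup₂_of_le μ hμ le_rfl

end Product

/-- The product of measures is Scott-continuous in its first argument: it is monotone
with respect to `⊑`, and preserves `⊑`-suprema of nonempty `⊑`-directed families, where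
measures on the product are compared on the Scott-open sets of the product order. -/
theorem prod_measure_scottCont {H₁ H₂ : Type*} [Countable H₁] [Countable H₂]
    (ν : @Measure (Set H₂) (scottBorel H₂))
    (hν : @IsProbabilityMeasure (Set H₂) (scottBorel H₂) ν) :
    (∀ μ₁ μ₂ : @Measure (Set H₁) (scottBorel H₁),
      @IsProbabilityMeasure (Set H₁) (scottBorel H₁) μ₁ →
      @IsProbabilityMeasure (Set H₁) (scottBorel H₁) μ₂ →
      MeasLE μ₁ μ₂ →
      ∀ W : Set (Set H₁ × Set H₂), ScottOpenProd W →
        (@Measure.prod _ _ (scottBorel H₁) (scottBorel H₂) μ₁ ν) W ≤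
        (@Measure.prod _ _ (scottBorel H₁) (scottBorel H₂) μ₂ ν) W) ∧
    (∀ (D : Set (@Measure (Set H₁) (scottBorel H₁)))
        (μstar : @Measure (Set H₁) (scottBorel H₁)),
      D.Nonempty → (∀ μ ∈ D, @IsProbabilityMeasure (Set H₁) (scottBorel H₁) μ) →
      DirectedOn MeasLE D →
      @IsProbabilityMeasure (Set H₁) (scottBorel H₁) μstar →
      (∀ U : Set (Set H₁), ScottOpen U → μstar U = ⨆ μ ∈ D, μ U) →
      ∀ W : Set (Set H₁ × Set H₂), ScottOpenProd W →
        (@Measure.prod _ _ (scottBorel H₁) (scottBorel H₂) μstar ν) W =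
          ⨆ μ ∈ D, (@Measure.prod _ _ (scottBorel H₁) (scottBorel H₂) μ ν) W) := by
  refine ⟨fun μ₁ μ₂ h₁ h₂ hle W hW => ?_, fun D μstar hD hprob hdir hstar hsup W hW => ?_⟩
  · let := scottBorel H₁
    let := scottBorel H₂
    exact prod_mono_of_measLE ν hle hW
  · let := scottBorel H₁
    let := scottBorel H₂
    exact prod_eq_iSup_of_directedOn ν hD (fun μ hμ => have := hprob μ hμ; inferInstance)
      hdir hsup hW
end

section
/- Let κ be a type and X := κ → Set H with the componentwise inclusion order, and let f : X → Set H be Scott-continuous (monotone, and f(⨆ D) = ⋃_{x ∈ D} f(x) for every nonempty directed family D in X, where suprema in X are componentwise unions). Then f is measurable from the σ-algebra generated by the Scott topology of X to 𝔅, and the pushforward operation μ ↦ f_*μ on probability measures is Scott-continuous with respect to ⊑: if μ ⊑ ν then f_*μ ⊑ f_*ν, and if D is a nonempty ⊑-directed family of probability measures on X with ⊑-supremum μ*, then f_*μ* is the ⊑-supremum of { f_*μ : μ ∈ D }. -/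
open MeasureTheory Set ENNReal

/-- Scott-open subsets of `X = κ → Set H` with the componentwise inclusion order:
upper sets meeting every directed family whose componentwise union they contain. -/
def ScottOpenPi {κ H : Type*} (U : Set (κ → Set H)) : Prop :=
  (∀ ⦃x y : κ → Set H⦄, x ≤ y → x ∈ U → y ∈ U) ∧
  ∀ D : Set (κ → Set H), D.Nonempty → DirectedOn (· ≤ ·) D →
    (fun i => ⋃ x ∈ D, x i) ∈ U → (D ∩ U).Nonempty

/-- The Borel σ-algebra on `κ → Set H` generated by the Scott-open sets. -/
def scottBorelPi (κ H : Type*) : MeasurableSpace (κ → Set H) :=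
  MeasurableSpace.generateFrom {U : Set (κ → Set H) | ScottOpenPi U}

/-- The order `μ ⊑ ν` on measures on `κ → Set H`. -/
def MeasLEPi {κ H : Type*} (μ ν : @Measure (κ → Set H) (scottBorelPi κ H)) : Prop :=
  ∀ U : Set (κ → Set H), ScottOpenPi U → μ U ≤ ν U

/-- The preimage of a Scott-open set under a Scott-continuous map is Scott-open. -/
theorem ScottOpen.preimage {κ H : Type*} {f : (κ → Set H) → Set H} (hmono : Monotone f)
    (hsup : ∀ D : Set (κ → Set H), D.Nonempty → DirectedOn (· ≤ ·) D →
      f (fun i => ⋃ x ∈ D, x i) = ⋃ x ∈ D, f x)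
    {U : Set (Set H)} (hU : ScottOpen U) : ScottOpenPi (f ⁻¹' U) := by
  refine ⟨fun x y hxy hx => hU.1 (hmono hxy) hx, fun D hD hdir hmem => ?_⟩
  rw [mem_preimage, hsup D hD hdir, ← sUnion_image] at hmem
  have hdir' : DirectedOn (· ⊆ ·) (f '' D) :=
    directedOn_image.2 (hdir.mono fun {_ _} h => hmono h)
  obtain ⟨_, ⟨x, hx, rfl⟩, hxU⟩ := hU.2 (f '' D) (hD.image f) hdir' hmem
  exact ⟨x, hx, hxU⟩

/-- A Scott-continuous map `f : (κ → Set H) → Set H` is measurable, and the pushforward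
operation `μ ↦ f_* μ` is Scott-continuous with respect to `⊑`: it is monotone and
maps a `⊑`-supremum of a nonempty `⊑`-directed family to the `⊑`-supremum of the
pushforwards. -/
theorem pushforward_scottCont {κ H : Type*} [Countable H]
    (f : (κ → Set H) → Set H)
    (hmono : Monotone f)
    (hsup : ∀ D : Set (κ → Set H), D.Nonempty → DirectedOn (· ≤ ·) D →
      f (fun i => ⋃ x ∈ D, x i) = ⋃ x ∈ D, f x) :
    @Measurable (κ → Set H) (Set H) (scottBorelPi κ H) (scottBorel H) f ∧
    (∀ μ ν : @Measure (κ → Set H) (scottBorelPi κ H),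
      @IsProbabilityMeasure _ (scottBorelPi κ H) μ →
      @IsProbabilityMeasure _ (scottBorelPi κ H) ν →
      MeasLEPi μ ν →
      MeasLE (@Measure.map _ _ (scottBorelPi κ H) (scottBorel H) f μ)
             (@Measure.map _ _ (scottBorelPi κ H) (scottBorel H) f ν)) ∧
    (∀ (D : Set (@Measure (κ → Set H) (scottBorelPi κ H)))
        (μstar : @Measure (κ → Set H) (scottBorelPi κ H)),
      D.Nonempty → (∀ μ ∈ D, @IsProbabilityMeasure _ (scottBorelPi κ H) μ) →
      DirectedOn MeasLEPi D →
      @IsProbabilityMeasure _ (scottBorelPi κ H) μstar →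
      (∀ U : Set (κ → Set H), ScottOpenPi U → μstar U = ⨆ μ ∈ D, μ U) →
      ∀ U : Set (Set H), ScottOpen U →
        (@Measure.map _ _ (scottBorelPi κ H) (scottBorel H) f μstar) U =
          ⨆ μ ∈ D, (@Measure.map _ _ (scottBorelPi κ H) (scottBorel H) f μ) U) := by
  have hf : @Measurable _ _ (scottBorelPi κ H) (scottBorel H) f :=
    @measurable_generateFrom _ _ (scottBorelPi κ H) _ _ fun U hU =>
      MeasurableSpace.measurableSet_generateFrom (hU.preimage hmono hsup)
  have hmap (μ : @Measure (κ → Set H) (scottBorelPi κ H)) {U : Set (Set H)} (hU : ScottOpen U) :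
      (@Measure.map _ _ (scottBorelPi κ H) (scottBorel H) f μ) U = μ (f ⁻¹' U) :=
    @Measure.map_apply _ _ (scottBorelPi κ H) (scottBorel H) μ f hf U
      (MeasurableSpace.measurableSet_generateFrom hU)
  refine ⟨hf, fun μ ν _ _ hle U hU => ?_, fun D μstar _ _ _ _ hstar U hU => ?_⟩
  · rw [hmap μ hU, hmap ν hU]
    exact hle _ (hU.preimage hmono hsup)
  · simp only [hmap _ hU]
    exact hstar _ (hU.preimage hmono hsup)
end

section
/- For any types H₁ and H₂, the Scott topology on the product Set H₁ × Set H₂ (with the componentwise inclusion order) coincides with the product topology of the Scott topology on Set H₁ and the Scott topology on Set H₂. -/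
open MeasureTheory Set

/-- The Scott topology on `Set H` (the Scott-open sets form a topology, so it is
the topology generated by them). -/
def scottTop (H : Type*) : TopologicalSpace (Set H) :=
  TopologicalSpace.generateFrom {U : Set (Set H) | ScottOpen U}

theorem ScottOpen.inter {H : Type*} {U V : Set (Set H)} (hU : ScottOpen U) (hV : ScottOpen V) :
    ScottOpen (U ∩ V) := by
  refine ⟨fun a b hab h => ⟨hU.1 hab h.1, hV.1 hab h.2⟩, fun D hne hD h => ?_⟩
  obtain ⟨a, haD, haU⟩ := hU.2 D hne hD h.1
  obtain ⟨b, hbD, hbV⟩ := hV.2 D hne hD h.2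
  obtain ⟨c, hcD, hac, hbc⟩ := hD a haD b hbD
  exact ⟨c, hcD, hU.1 hac haU, hV.1 hbc hbV⟩

theorem ScottOpen.sUnion {H : Type*} {S : Set (Set (Set H))} (hS : ∀ U ∈ S, ScottOpen U) :
    ScottOpen (⋃₀ S) := by
  refine ⟨fun a b hab ⟨U, hUS, haU⟩ => ⟨U, hUS, (hS U hUS).1 hab haU⟩, ?_⟩
  rintro D hne hD ⟨U, hUS, hU⟩
  obtain ⟨a, haD, haU⟩ := (hS U hUS).2 D hne hD hU
  exact ⟨a, haD, U, hUS, haU⟩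

theorem isOpen_scottTop_iff {H : Type*} {U : Set (Set H)} :
    @IsOpen _ (scottTop H) U ↔ ScottOpen U := by
  refine ⟨fun h => ?_, fun h => TopologicalSpace.GenerateOpen.basic U h⟩
  induction h with
  | basic U hU => exact hU
  | univ => exact ⟨fun _ _ _ _ => trivial, fun D hne _ _ => by simpa using hne⟩
  | inter U V _ _ hU hV => exact hU.inter hV
  | sUnion S _ hS => exact ScottOpen.sUnion hS

theorem scottOpen_Ici_of_finite {H : Type*} {b : Set H} (hb : b.Finite) :
    ScottOpen {c : Set H | b ⊆ c} := by
  refine ⟨fun _ _ hcd hc => hc.trans hcd, fun D hne hD h => ?_⟩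
  exact hD.exists_mem_subset_of_finite_of_subset_sUnion hne hb h

theorem ScottOpenProd.exists_finite {H₁ H₂ : Type*} {W : Set (Set H₁ × Set H₂)}
    (hW : ScottOpenProd W) {a : Set H₁} {b : Set H₂} (h : (a, b) ∈ W) :
    ∃ s t, s.Finite ∧ t.Finite ∧ s ⊆ a ∧ t ⊆ b ∧ (s, t) ∈ W := by
  let D : Set (Set H₁ × Set H₂) := {p | p.1.Finite ∧ p.2.Finite ∧ p.1 ⊆ a ∧ p.2 ⊆ b}
  have hD : DirectedOn (fun p q => p.1 ⊆ q.1 ∧ p.2 ⊆ q.2) D := by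
    rintro p ⟨hp₁, hp₂, hpa, hpb⟩ q ⟨hq₁, hq₂, hqa, hqb⟩
    exact ⟨(p.1 ∪ q.1, p.2 ∪ q.2),
      ⟨hp₁.union hq₁, hp₂.union hq₂, union_subset hpa hqa, union_subset hpb hqb⟩,
      ⟨subset_union_left, subset_union_left⟩, ⟨subset_union_right, subset_union_right⟩⟩
  have ha : a ⊆ ⋃ p ∈ D, p.1 := fun x hx =>
    mem_biUnion (x := (({x}, ∅) : Set H₁ × Set H₂)) (by simp [D, hx]) rfl
  have hb : b ⊆ ⋃ p ∈ D, p.2 := fun x hx =>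
    mem_biUnion (x := ((∅, {x}) : Set H₁ × Set H₂)) (by simp [D, hx]) rfl
  obtain ⟨⟨s, t⟩, ⟨hs, ht, hsa, htb⟩, hst⟩ :=
    hW.2 D ⟨(∅, ∅), by simp [D]⟩ hD (hW.1 (p := (a, b)) ha hb h)
  exact ⟨s, t, hs, ht, hsa, htb, hst⟩

theorem ScottOpen.exists_mem_of_biUnion_mem {H ι : Type*} {U : Set (Set H)} (hU : ScottOpen U)
    {D : Set ι} (hne : D.Nonempty) {f : ι → Set H} (hD : DirectedOn (fun i j => f i ⊆ f j) D)
    (h : ⋃ i ∈ D, f i ∈ U) : ∃ i ∈ D, f i ∈ U := by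
  rw [← sUnion_image] at h
  obtain ⟨_, ⟨i, hi, rfl⟩, hiU⟩ := hU.2 (f '' D) (hne.image f) (directedOn_image.2 hD) h
  exact ⟨i, hi, hiU⟩

/-- The Scott topology on the product `Set H₁ × Set H₂` (with the componentwise
inclusion order) coincides with the product topology of the Scott topologies on the
two factors. -/
theorem scottTop_prod_eq_prod_scottTop (H₁ H₂ : Type*) :
    {W : Set (Set H₁ × Set H₂) | ScottOpenProd W} =
      {W : Set (Set H₁ × Set H₂) |
        (@instTopologicalSpaceProd (Set H₁) (Set H₂) (scottTop H₁) (scottTop H₂)).IsOpen W} := by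
  let := scottTop H₁
  let := scottTop H₂
  ext W
  change ScottOpenProd W ↔ IsOpen W
  rw [isOpen_prod_iff]
  constructor
  · intro hW a b h
    obtain ⟨s, t, hs, ht, hsa, htb, hst⟩ := hW.exists_finite h
    exact ⟨{c | s ⊆ c}, {c | t ⊆ c}, isOpen_scottTop_iff.2 (scottOpen_Ici_of_finite hs),
      isOpen_scottTop_iff.2 (scottOpen_Ici_of_finite ht), hsa, htb,
      fun p ⟨hsp, htp⟩ => hW.1 (p := (s, t)) hsp htp hst⟩
  · intro hW
    refine ⟨fun p q h₁ h₂ hp => ?_, fun D hne hD h => ?_⟩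
    · obtain ⟨U, V, hU, hV, hpU, hpV, hUV⟩ := hW p.1 p.2 hp
      exact hUV ⟨(isOpen_scottTop_iff.1 hU).1 h₁ hpU, (isOpen_scottTop_iff.1 hV).1 h₂ hpV⟩
    · obtain ⟨U, V, hU, hV, hDU, hDV, hUV⟩ := hW _ _ h
      rw [isOpen_scottTop_iff] at hU hV
      obtain ⟨p, hpD, hpU⟩ := hU.exists_mem_of_biUnion_mem hne (hD.mono' fun _ _ _ _ h => h.1) hDU
      obtain ⟨q, hqD, hqV⟩ := hV.exists_mem_of_biUnion_mem hne (hD.mono' fun _ _ _ _ h => h.2) hDV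
      obtain ⟨r, hrD, hpr, hqr⟩ := hD p hpD q hqD
      exact ⟨r, hrD, hUV ⟨hU.1 hpr.1 hpU, hV.1 hqr.2 hqV⟩⟩
end
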